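/- Fix an approximating function ψ (strictly positive, non-increasing). Then for Lebesgue-almost all x ∈ [0,1]², if ∑_{r=1}^∞ ψ(r) log(1/ψ(r)) = ∞ then the set W_M^x(ψ) := { γ ∈ [0,1]² : ‖q x₁ − γ₁‖·‖q x₂ − γ₂‖ ≤ ψ(|q|) for infinitely many nonzero integers q } has Lebesgue measure 1, and if ∑_{r=1}^∞ ψ(r) log(1/ψ(r)) < ∞ then W_M^x(ψ) has Lebesgue measure 0. -/

import Mathlib

open MeasureTheory Set Filter

/-- Distance to the nearest integer. -/
noncomputable def nint (y : ℝ) : ℝ := |y - (round y : ℝ)|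

/-- `pw y e = y ^ (1/e)`, with the convention that `y ^ (1/0) = 0`. -/
noncomputable def pw (y e : ℝ) : ℝ := if e = 0 then 0 else y ^ (1 / e)

/-- A vector is irrational if `1, x₁, x₂` are linearly independent over `ℚ`. -/
def IrrVec (x : ℝ × ℝ) : Prop :=
  ∀ a b c : ℤ, (a : ℝ) * x.1 + (b : ℝ) * x.2 + (c : ℝ) = 0 → a = 0 ∧ b = 0 ∧ c = 0

/-- The set `Bad(i,j)` of `(i,j)`-badly approximable vectors. -/
def Badij (i j : ℝ) (x : ℝ × ℝ) : Prop :=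
  IrrVec x ∧ ∃ c > (0 : ℝ), ∀ q : ℕ, 0 < q →
    max (pw (nint (q * x.1)) i) (pw (nint (q * x.2)) j) > c / q

/-- The twisted well-approximable set `W^x_{(i,j)}(ψ)`. -/
def twistedW (x : ℝ × ℝ) (i j : ℝ) (ψ : ℕ → ℝ) : Set (ℝ × ℝ) :=
  {γ ∈ Set.Icc (0 : ℝ × ℝ) 1 |
    {q : ℤ | q ≠ 0 ∧
      max (pw (nint (q * x.1 - γ.1)) i) (pw (nint (q * x.2 - γ.2)) j)
        ≤ ψ q.natAbs}.Infinite}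


open ProbabilityTheory

/-- The two-dimensional torus. -/
abbrev TT : Type := UnitAddCircle × UnitAddCircle

/-- Product of the distances to the nearest integers, on the torus. -/
noncomputable def NN (z : TT) : ℝ := ‖z.1‖ * ‖z.2‖

instance instProbC : IsProbabilityMeasure (volume : Measure UnitAddCircle) :=
  ⟨by simpa using UnitAddCircle.measure_univ⟩

instance instProbT : IsProbabilityMeasure (volume : Measure TT) := by
  rw [Measure.volume_eq_prod]; infer_instance

instance instProbTT : IsProbabilityMeasure (volume : Measure (TT × TT)) := by
  rw [Measure.volume_eq_prod]; infer_instance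

instance instHaarT : Measure.IsAddHaarMeasure (volume : Measure TT) := by
  rw [Measure.volume_eq_prod]; infer_instance

instance instHaarTT : Measure.IsAddHaarMeasure (volume : Measure (TT × TT)) := by
  rw [Measure.volume_eq_prod]
  exact Measure.prod.instIsAddHaarMeasure _ _

lemma measurable_NN : Measurable NN := by
  unfold NN
  fun_prop

/-- the sublevel set -/
def AA (ε : ℝ) : Set TT := {z | NN z ≤ ε}

lemma measurableSet_AA (ε : ℝ) : MeasurableSet (AA ε) :=
  measurableSet_le measurable_NN measurable_const

lemma vol_ball (r : ℝ) : volume {a : UnitAddCircle | ‖a‖ ≤ r} = ENNReal.ofReal (min 1 (2 * r)) := by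
  rw [← AddCircle.volume_closedBall (1 : ℝ) (x := 0)]
  congr 1
  ext a
  simp

lemma vol_rect (s t : Set UnitAddCircle) :
    volume (s ×ˢ t : Set TT) = volume s * volume t := by
  rw [Measure.volume_eq_prod, Measure.prod_prod]

lemma norm_le_half' (a : UnitAddCircle) : ‖a‖ ≤ 1 / 2 := by
  simpa using AddCircle.norm_le_half_period (1 : ℝ) (x := a) one_ne_zero

lemma NN_nonneg (z : TT) : 0 ≤ NN z := by unfold NN; positivity

lemma AA_upper (ε : ℝ) (h0 : 0 < ε) (h1 : ε ≤ 1 / 2) :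
    (volume : Measure TT).real (AA ε) ≤ 10 / Real.log 2 * (ε * Real.log (1 / ε)) := by
  obtain ⟨n, hn1, hn2⟩ := exists_nat_pow_near (x := 1 / ε) (y := (2 : ℝ))
    (by rw [le_div_iff₀ h0]; linarith) (by norm_num)
  have hn : 1 ≤ n := by
    by_contra h
    have : n = 0 := by omega
    subst this
    rw [div_lt_iff₀ h0] at hn2
    norm_num at hn2
    linarith
  have hlog : n * Real.log 2 ≤ Real.log (1 / ε) := by
    rw [← Real.log_pow]
    exact Real.log_le_log (by positivity) hn1
  have hcov : AA ε ⊆ ({a : UnitAddCircle | ‖a‖ ≤ ε} ×ˢ (univ : Set UnitAddCircle)) ∪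
      ⋃ k ∈ Finset.range n, ({a : UnitAddCircle | ‖a‖ ≤ (1 / 2) ^ (k + 1)} ×ˢ
        {b : UnitAddCircle | ‖b‖ ≤ 2 ^ (k + 2) * ε}) := by
    rintro ⟨a, b⟩ hab
    simp only [AA, NN, mem_setOf_eq] at hab
    by_cases ha : ‖a‖ ≤ ε
    · left; simp [ha]
    · right
      push Not at ha
      have ha0 : 0 < ‖a‖ := h0.trans ha
      obtain ⟨m, hm1, hm2⟩ := exists_nat_pow_near (x := 1 / ‖a‖) (y := (2 : ℝ))
        (by rw [le_div_iff₀ ha0]; linarith [norm_le_half' a]) (by norm_num)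
      rw [le_div_iff₀ ha0] at hm1
      rw [div_lt_iff₀ ha0] at hm2
      have hm : 1 ≤ m := by
        by_contra h
        have : m = 0 := by omega
        subst this
        have := norm_le_half' a
        norm_num at hm2
        linarith
      have hmn : m < n + 1 := by
        rw [div_lt_iff₀ h0] at hn2
        by_contra h
        have h2 : (2 : ℝ) ^ (n + 1) ≤ 2 ^ m := pow_le_pow_right₀ (by norm_num) (by omega)
        have : (2 : ℝ) ^ (n + 1) * ε ≤ 2 ^ m * ‖a‖ := by gcongr
        linarith
      obtain ⟨k, rfl⟩ : ∃ k, m = k + 1 := ⟨m - 1, by omega⟩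
      simp only [mem_iUnion, Finset.mem_range]
      refine ⟨k, by omega, ?_⟩
      simp only [mem_prod, mem_setOf_eq]
      refine ⟨?_, ?_⟩
      · rw [one_div, inv_pow, ← one_div, le_div_iff₀ (by positivity)]; linarith
      · have hb := norm_nonneg b
        calc ‖b‖ = 1 * ‖b‖ := by ring
          _ ≤ (2 ^ (k + 2) * ‖a‖) * ‖b‖ := by gcongr
          _ = 2 ^ (k + 2) * (‖a‖ * ‖b‖) := by ring
          _ ≤ _ := by gcongr
  have hr1 : volume.real ({a : UnitAddCircle | ‖a‖ ≤ ε} ×ˢ (univ : Set UnitAddCircle)) ≤ 2 * ε := by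
    rw [measureReal_def, vol_rect, vol_ball, measure_univ, mul_one]
    rw [ENNReal.toReal_ofReal (by positivity)]
    exact min_le_right _ _
  have hr2 : ∀ k : ℕ, volume.real ({a : UnitAddCircle | ‖a‖ ≤ (1 / 2) ^ (k + 1)} ×ˢ
        {b : UnitAddCircle | ‖b‖ ≤ 2 ^ (k + 2) * ε}) ≤ 8 * ε := by
    intro k
    rw [measureReal_def, vol_rect, vol_ball, vol_ball, ENNReal.toReal_mul,
      ENNReal.toReal_ofReal (by positivity), ENNReal.toReal_ofReal (by positivity)]
    calc _ ≤ (2 * (1 / 2) ^ (k + 1)) * (2 * (2 ^ (k + 2) * ε)) := by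
            gcongr <;> exact min_le_right _ _
      _ = 8 * ε * ((1 / 2) * 2) ^ k := by rw [mul_pow]; ring
      _ = 8 * ε := by norm_num
  have hmain : (volume : Measure TT).real (AA ε) ≤ 2 * ε + n * (8 * ε) := by
    refine (measureReal_mono hcov).trans ((measureReal_union_le _ _).trans ?_)
    gcongr
    refine (measureReal_biUnion_finset_le _ _).trans ?_
    refine (Finset.sum_le_sum (fun k _ => hr2 k)).trans ?_
    simp
  have hl2 : 0 < Real.log 2 := Real.log_pos (by norm_num)
  have hn' : (1 : ℝ) ≤ n := by exact_mod_cast hn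
  have h3 : 2 * ε + n * (8 * ε) ≤ 10 * ε * n := by nlinarith
  have h4 : 10 * ε * n ≤ 10 / Real.log 2 * (ε * Real.log (1 / ε)) := by
    rw [div_mul_eq_mul_div, le_div_iff₀ hl2]
    nlinarith
  linarith

lemma AA_lower (ε : ℝ) (h0 : 0 < ε) (h1 : ε < 1) :
    1 / 3 * (ε * Real.log (1 / ε)) ≤ (volume : Measure TT).real (AA ε) := by
  by_cases h4 : 1 / 4 ≤ ε
  · have : AA ε = univ := by
      ext ⟨a, b⟩
      simp only [AA, NN, mem_setOf_eq, mem_univ, iff_true]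
      have := norm_le_half' a
      have := norm_le_half' b
      have := norm_nonneg a
      have := norm_nonneg b
      nlinarith
    rw [this, measureReal_def, measure_univ]
    have h5 : Real.log (1 / ε) ≤ 1 / ε - 1 := Real.log_le_sub_one_of_pos (by positivity)
    have h6 : ε * Real.log (1 / ε) ≤ ε * (1 / ε - 1) := by gcongr
    have h7 : ε * (1 / ε - 1) = 1 - ε := by field_simp
    simp only [ENNReal.toReal_one]
    linarith
  push Not at h4
  obtain ⟨n, hn1, hn2⟩ := exists_nat_pow_near (x := 1 / ε) (y := (2 : ℝ))
    (by rw [le_div_iff₀ h0]; linarith) (by norm_num)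
  have hn : 2 ≤ n := by
    by_contra h
    rw [div_lt_iff₀ h0] at hn2
    have h2 : (2 : ℝ) ^ (n + 1) ≤ 2 ^ 2 := pow_le_pow_right₀ (by norm_num) (by omega)
    have : (2 : ℝ) ^ (n + 1) * ε ≤ 2 ^ 2 * ε := by gcongr
    linarith
  obtain ⟨m, rfl⟩ : ∃ m, n = m + 1 := ⟨n - 1, by omega⟩
  rw [le_div_iff₀ h0] at hn1
  have hlog : Real.log (1 / ε) ≤ (m + 2 : ℝ) * Real.log 2 := by
    have : (m + 2 : ℝ) = ((m + 1 + 1 : ℕ) : ℝ) := by push_cast; ring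
    rw [this, ← Real.log_pow]
    exact Real.log_le_log (by positivity) hn2.le
  let B : ℕ → Set UnitAddCircle := fun k => {a | ‖a‖ ≤ (1 / 2) ^ (k + 1)}
  let R : ℕ → Set TT := fun k => (B k \ B (k + 1)) ×ˢ
        {b : UnitAddCircle | ‖b‖ ≤ 2 ^ (k + 1) * ε}
  have hBm : ∀ k, MeasurableSet (B k) := fun k =>
    measurableSet_le measurable_norm measurable_const
  have hBanti : Antitone B := by
    intro i j hij a ha
    simp only [B, mem_setOf_eq] at ha ⊢
    exact ha.trans (pow_le_pow_of_le_one (by norm_num) (by norm_num) (by omega))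
  have hBv : ∀ k, volume.real (B k) = (1 / 2) ^ k := by
    intro k
    have : (1 / 2 : ℝ) ^ k ≤ 1 := pow_le_one₀ (by norm_num) (by norm_num)
    rw [measureReal_def, vol_ball, ENNReal.toReal_ofReal (by positivity), min_eq_right]
    · rw [pow_succ]; ring
    · rw [pow_succ]; linarith
  have hRm : ∀ k, MeasurableSet (R k) := fun k =>
    ((hBm k).diff (hBm _)).prod (measurableSet_le measurable_norm measurable_const)
  have hdisj : Pairwise (fun i j => Disjoint (R i) (R j)) := by
    refine (pairwise_disjoint_on R).2 ?_
    intro i j hij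
    rw [Set.disjoint_left]
    rintro ⟨a, b⟩ h h'
    exact h.1.2 (hBanti (Nat.succ_le_of_lt hij) h'.1.1)
  have hsub : (⋃ k ∈ Finset.range m, R k) ⊆ AA ε := by
    rintro ⟨a, b⟩ h
    simp only [mem_iUnion] at h
    obtain ⟨k, -, h⟩ := h
    have ha : ‖a‖ ≤ (1 / 2) ^ (k + 1) := h.1.1
    have hb : ‖b‖ ≤ 2 ^ (k + 1) * ε := h.2
    simp only [AA, NN, mem_setOf_eq]
    calc ‖a‖ * ‖b‖ ≤ (1 / 2) ^ (k + 1) * (2 ^ (k + 1) * ε) := by gcongr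
      _ = ((1 / 2) * 2) ^ (k + 1) * ε := by rw [mul_pow]; ring
      _ = ε := by norm_num
  have hRv : ∀ k ∈ Finset.range m, volume.real (R k) = 2 * ε := by
    intro k hk
    have hk' : k < m := Finset.mem_range.1 hk
    rw [measureReal_def, vol_rect, ENNReal.toReal_mul, ← measureReal_def,
      measureReal_diff (hBanti (Nat.le_succ k)) (hBm _), hBv, hBv, vol_ball,
      ENNReal.toReal_ofReal (by positivity), min_eq_right]
    · calc _ = 2 * ε * ((1 / 2) * 2) ^ k := by rw [mul_pow]; ring
        _ = _ := by norm_num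
    · have h2 : (2 : ℝ) ^ (k + 2) ≤ 2 ^ (m + 1) := pow_le_pow_right₀ (by norm_num) (by omega)
      calc 2 * (2 ^ (k + 1) * ε) = 2 ^ (k + 2) * ε := by ring
        _ ≤ 2 ^ (m + 1) * ε := by gcongr
        _ ≤ 1 := hn1
  have hmain : m * (2 * ε) ≤ (volume : Measure TT).real (AA ε) := by
    refine le_trans ?_ (measureReal_mono hsub)
    rw [measureReal_biUnion_finset (fun i _ j _ hij => hdisj hij) (fun k _ => hRm k),
      Finset.sum_congr rfl hRv]
    simp
  have hl2 : Real.log 2 ≤ 1 := by linarith [Real.log_two_lt_d9]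
  have hm1 : (1 : ℝ) ≤ m := by exact_mod_cast (by omega : 1 ≤ m)
  have : ε * Real.log (1 / ε) ≤ ε * ((m + 2) * 1) := by
    gcongr
    exact hlog.trans (by gcongr)
  nlinarith

lemma surj_TT (p q : ℤ) (h : p ≠ q) :
    MeasurePreserving (fun z : TT × TT => (p • z.1 - z.2, q • z.1 - z.2)) volume volume := by
  let f : TT × TT →+ TT × TT :=
    { toFun := fun z => (p • z.1 - z.2, q • z.1 - z.2)
      map_zero' := by simp
      map_add' := by
        intro x y
        simp only [Prod.fst_add, Prod.snd_add, smul_add, Prod.mk_add_mk]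
        congr 1 <;> abel }
  have hc : Continuous f := by
    change Continuous fun z : TT × TT => (p • z.1 - z.2, q • z.1 - z.2)
    fun_prop
  have hs : Function.Surjective f := by
    rintro ⟨a, b⟩
    have hpq : p - q ≠ 0 := sub_ne_zero.2 h
    let x : TT := DivisibleBy.div (a - b) (p - q)
    have hx : (p - q) • x = a - b := DivisibleBy.div_cancel (a - b) hpq
    refine ⟨(x, p • x - a), ?_⟩
    change (p • x - (p • x - a), q • x - (p • x - a)) = (a, b)
    rw [sub_smul] at hx
    congr 1
    · abel
    · rw [sub_sub_eq_add_sub, add_comm, add_sub_assoc, ← neg_sub (p • x), hx]; abel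
  exact AddMonoidHom.measurePreserving hc hs (by simp)

lemma mp_Y (p : ℤ) :
    MeasurePreserving (fun z : TT × TT => p • z.1 - z.2) volume volume := by
  have h := surj_TT p (p + 1) (by simp)
  have h2 : MeasurePreserving (Prod.fst : TT × TT → TT) volume volume := by
    rw [Measure.volume_eq_prod TT TT]
    exact measurePreserving_fst
  exact h2.comp h

lemma indep_Y (p q : ℤ) (h : p ≠ q) :
    IndepFun (fun z : TT × TT => p • z.1 - z.2) (fun z : TT × TT => q • z.1 - z.2) volume := by
  rw [indepFun_iff_map_prod_eq_prod_map_map (mp_Y p).measurable.aemeasurable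
    (mp_Y q).measurable.aemeasurable, (mp_Y p).map_eq, (mp_Y q).map_eq, (surj_TT p q h).map_eq]
  rfl

/-- Borel-Cantelli for pairwise independent indicator-type variables. -/
lemma bc_pairwise {Ω : Type*} [MeasurableSpace Ω] (μ : Measure Ω) [IsProbabilityMeasure μ]
    (E : ℕ → Set Ω) (hE : ∀ n, MeasurableSet (E n))
    (hind : Pairwise fun i j => IndepFun ((E i).indicator (1 : Ω → ℝ)) ((E j).indicator (1 : Ω → ℝ)) μ)
    (hdiv : ¬ Summable fun n => μ.real (E n)) :
    ∀ᵐ ω ∂μ, {n | ω ∈ E n}.Infinite := by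
  classical
  let X : ℕ → Ω → ℝ := fun n => (E n).indicator 1
  have hXm : ∀ n, Measurable (X n) := fun n => measurable_one.indicator (hE n)
  have hXL : ∀ n, MemLp (X n) 2 μ := fun n => (memLp_const (1 : ℝ)).indicator (hE n)
  have hXi : ∀ n, ∫ ω, X n ω ∂μ = μ.real (E n) := fun n => integral_indicator_one (hE n)
  have hXv : ∀ n, Var[X n; μ] ≤ μ.real (E n) := by
    intro n
    refine (variance_le_expectation_sq (hXm n).aestronglyMeasurable).trans (le_of_eq ?_)
    rw [← hXi n]
    congr 1
    ext ω
    simp only [X, Pi.pow_apply, indicator]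
    split_ifs <;> simp
  let S : ℕ → ℝ := fun N => ∑ n ∈ Finset.range N, μ.real (E n)
  have hS : Tendsto S atTop atTop :=
    (not_summable_iff_tendsto_nat_atTop_of_nonneg (fun n => measureReal_nonneg)).1 hdiv
  have key : ∀ M : ℕ, μ {ω | {n | ω ∈ E n}.Finite ∧ {n | ω ∈ E n}.ncard ≤ M} = 0 := by
    intro M
    have hle : ∀ᶠ N in atTop, μ {ω | {n | ω ∈ E n}.Finite ∧ {n | ω ∈ E n}.ncard ≤ M}
        ≤ ENNReal.ofReal (4 / S N) := by
      filter_upwards [hS.eventually_ge_atTop (2 * M + 1)] with N hN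
      have hSpos : 0 < S N := by linarith [(Nat.cast_nonneg M : (0:ℝ) ≤ M)]
      have hL : MemLp (∑ n ∈ Finset.range N, X n) 2 μ := memLp_finset_sum' _ (fun n _ => hXL n)
      have hint : ∫ ω, (∑ n ∈ Finset.range N, X n) ω ∂μ = S N := by
        simp only [Finset.sum_apply]
        rw [integral_finset_sum _ (fun n _ => (hXL n).integrable (by norm_num))]
        exact Finset.sum_congr rfl (fun n _ => hXi n)
      have hvar : Var[∑ n ∈ Finset.range N, X n; μ] ≤ S N := by
        rw [IndepFun.variance_sum (fun n _ => hXL n) (fun i _ j _ hij => hind hij)]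
        exact Finset.sum_le_sum (fun n _ => hXv n)
      have hch := meas_ge_le_variance_div_sq hL (c := S N / 2) (by positivity)
      rw [hint] at hch
      refine (measure_mono ?_).trans (hch.trans (ENNReal.ofReal_le_ofReal ?_))
      · rintro ω ⟨hfin, hcard⟩
        have h1 : (∑ n ∈ Finset.range N, X n) ω ≤ M := by
          have h2 : (∑ n ∈ Finset.range N, X n) ω
              = ((Finset.range N).filter (fun n => ω ∈ E n)).card := by
            rw [Finset.sum_apply, Finset.card_filter]
            push_cast
            refine Finset.sum_congr rfl (fun n _ => ?_)
            simp [X, indicator]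
          rw [h2]
          have h3 : ((Finset.range N).filter (fun n => ω ∈ E n)).card ≤ {n | ω ∈ E n}.ncard := by
            rw [← Set.ncard_coe_finset]
            refine Set.ncard_le_ncard ?_ hfin
            intro n hn
            simp at hn
            exact hn.2
          exact_mod_cast h3.trans hcard
        change S N / 2 ≤ |_|
        rw [abs_sub_comm]
        refine le_trans ?_ (le_abs_self _)
        linarith
      · calc _ ≤ S N / (S N / 2) ^ 2 := by gcongr
          _ = 4 / S N := by field_simp; norm_num
    have hlim : Tendsto (fun N => ENNReal.ofReal (4 / S N)) atTop (nhds 0) := by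
      rw [← ENNReal.ofReal_zero]
      exact ENNReal.tendsto_ofReal (hS.const_div_atTop 4)
    exact le_antisymm (ge_of_tendsto hlim hle) zero_le
  have := measure_iUnion_null key
  rw [ae_iff]
  refine measure_mono_null ?_ this
  intro ω hω
  simp only [mem_setOf_eq, Set.not_infinite] at hω
  exact mem_iUnion.2 ⟨_, hω, le_rfl⟩

lemma div_TT (ψ : ℕ → ℝ) (hpos : ∀ r, 0 < ψ r) (hlt : ∀ r, ψ r < 1)
    (hdiv : ¬ Summable (fun r => ψ r * Real.log (1 / ψ r))) :
    ∀ᵐ z : TT × TT, {q : ℤ | q ≠ 0 ∧ NN (q • z.1 - z.2) ≤ ψ q.natAbs}.Infinite := by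
  let E : ℕ → Set (TT × TT) := fun n => (fun z : TT × TT => (n : ℤ) • z.1 - z.2) ⁻¹' AA (ψ n)
  have hE : ∀ n, MeasurableSet (E n) := fun n => (mp_Y n).measurable (measurableSet_AA _)
  have hEv : ∀ n, volume.real (E n) = volume.real (AA (ψ n)) := fun n => by
    rw [measureReal_def, (mp_Y n).measure_preimage (measurableSet_AA _).nullMeasurableSet,
      measureReal_def]
  have h := bc_pairwise volume E hE ?_ ?_
  · filter_upwards [h] with z hz
    have hz' : ({n : ℕ | z ∈ E n} \ {0}).Infinite := hz.diff (Set.finite_singleton 0)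
    refine (hz'.image (Nat.cast_injective (R := ℤ)).injOn).mono ?_
    rintro _ ⟨n, ⟨hn, hn0⟩, rfl⟩
    refine ⟨by simpa using hn0, ?_⟩
    simpa [E, AA] using hn
  · intro i j hij
    have := (indep_Y i j (by exact_mod_cast hij)).comp
      (φ := (AA (ψ i)).indicator (1 : TT → ℝ)) (ψ := (AA (ψ j)).indicator (1 : TT → ℝ))
      (measurable_one.indicator (measurableSet_AA _)) (measurable_one.indicator (measurableSet_AA _))
    exact this
  · intro hs
    apply hdiv
    have h3 : Summable (fun r => 1 / 3 * (ψ r * Real.log (1 / ψ r))) := by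
      refine Summable.of_nonneg_of_le (fun r => ?_) (fun r => AA_lower _ (hpos r) (hlt r)) ?_
      · have : 0 ≤ Real.log (1 / ψ r) := Real.log_nonneg (by
          rw [le_div_iff₀ (hpos r)]; linarith [hlt r])
        have := (hpos r).le
        positivity
      · simpa only [hEv] using hs
    exact (summable_mul_left_iff (by norm_num)).1 h3

lemma conv_TT (ψ : ℕ → ℝ) (hpos : ∀ r, 0 < ψ r) (hanti : Antitone ψ) (hlt : ∀ r, ψ r < 1)
    (hsum : Summable (fun r => ψ r * Real.log (1 / ψ r))) (x : TT) :
    ∀ᵐ y : TT, {q : ℤ | q ≠ 0 ∧ NN (q • x - y) ≤ ψ q.natAbs}.Finite := by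
  have hmp : ∀ a : TT, MeasurePreserving (fun y : TT => a - y) volume volume := by
    intro a
    have h1 : MeasurePreserving (negAddMonoidHom : TT →+ TT) volume volume :=
      AddMonoidHom.measurePreserving (by exact continuous_neg) neg_surjective rfl
    have h2 := (measurePreserving_add_left (volume : Measure TT) a).comp h1
    have h3 : (fun y : TT => a - y) = (fun y => a + y) ∘ (negAddMonoidHom : TT →+ TT) := by
      ext y <;> simp [sub_eq_add_neg]
    rw [h3]
    exact h2
  obtain ⟨R, hR⟩ : ∃ R, ψ R ≤ 1 / 2 := by
    by_contra! h
    have h0 := hsum.tendsto_atTop_zero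
    have hl : 0 < Real.log (1 / ψ 0) := Real.log_pos (by
      rw [lt_div_iff₀ (hpos 0)]; linarith [hlt 0])
    have : ∀ r, 1 / 2 * Real.log (1 / ψ 0) ≤ ψ r * Real.log (1 / ψ r) := by
      intro r
      have h1 := hpos r
      have h2 := hanti (Nat.zero_le r)
      have h3 := h r
      gcongr
      exact one_div_pos.2 (hpos 0)
    have := ge_of_tendsto' h0 this
    linarith
  have hsA : Summable (fun r => volume.real (AA (ψ r))) := by
    rw [← summable_nat_add_iff R]
    refine Summable.of_nonneg_of_le (fun r => measureReal_nonneg)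
      (fun r => AA_upper _ (hpos _) ((hanti (Nat.le_add_left R r)).trans hR)) ?_
    exact ((summable_nat_add_iff R).2 hsum).mul_left _
  have hsZ : Summable (fun q : ℤ => volume.real (AA (ψ q.natAbs))) := by
    apply Summable.of_nat_of_neg
    · simpa using hsA
    · simpa using hsA
  have hfin : ∑' q : ℤ, volume {y : TT | q • x - y ∈ AA (ψ q.natAbs)} ≠ ⊤ := by
    have he : ∀ q : ℤ, volume {y : TT | q • x - y ∈ AA (ψ q.natAbs)}
        = ENNReal.ofReal (volume.real (AA (ψ q.natAbs))) := by
      intro q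
      rw [ofReal_measureReal]
      exact (hmp (q • x)).measure_preimage (measurableSet_AA _).nullMeasurableSet
    simp only [he]
    exact hsZ.tsum_ofReal_ne_top
  filter_upwards [ae_finite_setOf_mem hfin] with y hy
  refine hy.subset ?_
  rintro q ⟨-, hq⟩
  exact hq

/-- projection of the plane to the torus -/
def pr (x : ℝ × ℝ) : TT := (x.1, x.2)

lemma mp_pr : MeasurePreserving pr (volume.restrict (Icc (0 : ℝ × ℝ) 1)) volume := by
  have h1 : MeasurePreserving (fun t : ℝ => (t : UnitAddCircle))
      (volume.restrict (Icc (0 : ℝ) 1)) volume := by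
    rw [← restrict_Ioc_eq_restrict_Icc]
    simpa using UnitAddCircle.measurePreserving_mk 0
  have h2 := h1.prod h1
  rw [Measure.prod_restrict, ← Measure.volume_eq_prod, ← Measure.volume_eq_prod,
    Icc_prod_Icc] at h2
  exact h2

lemma nint_pr (q : ℤ) (x γ : ℝ × ℝ) :
    NN (q • pr x - pr γ) = nint (q * x.1 - γ.1) * nint (q * x.2 - γ.2) := by
  unfold nint
  rw [← UnitAddCircle.norm_eq, ← UnitAddCircle.norm_eq]
  simp [NN, pr, ← zsmul_eq_mul]

theorem stmt17 (ψ : ℕ → ℝ) (hpos : ∀ r, 0 < ψ r) (hanti : Antitone ψ)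
    (hlt : ∀ r, ψ r < 1) :
    ∀ᵐ x : ℝ × ℝ ∂(volume.restrict (Set.Icc (0 : ℝ × ℝ) 1)),
      (¬ Summable (fun r => ψ r * Real.log (1 / ψ r)) →
        volume {γ ∈ Set.Icc (0 : ℝ × ℝ) 1 |
          {q : ℤ | q ≠ 0 ∧
            nint (q * x.1 - γ.1) * nint (q * x.2 - γ.2) ≤ ψ q.natAbs}.Infinite} = 1) ∧
      (Summable (fun r => ψ r * Real.log (1 / ψ r)) →
        volume {γ ∈ Set.Icc (0 : ℝ × ℝ) 1 |
          {q : ℤ | q ≠ 0 ∧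
            nint (q * x.1 - γ.1) * nint (q * x.2 - γ.2) ≤ ψ q.natAbs}.Infinite} = 0) := by
  have hvol : volume (Icc (0 : ℝ × ℝ) 1) = 1 := by
    have := mp_pr.measure_preimage (s := univ) MeasurableSet.univ.nullMeasurableSet
    simpa using this
  have hA : ¬ Summable (fun r => ψ r * Real.log (1 / ψ r)) →
      ∀ᵐ x : ℝ × ℝ ∂(volume.restrict (Set.Icc (0 : ℝ × ℝ) 1)),
      volume {γ ∈ Set.Icc (0 : ℝ × ℝ) 1 |
          {q : ℤ | q ≠ 0 ∧
            nint (q * x.1 - γ.1) * nint (q * x.2 - γ.2) ≤ ψ q.natAbs}.Infinite} = 1 := by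
    intro hdiv
    have h := div_TT ψ hpos hlt hdiv
    rw [Measure.volume_eq_prod TT TT] at h
    have h2 := mp_pr.quasiMeasurePreserving.ae (Measure.ae_ae_of_ae_prod h)
    filter_upwards [h2] with x hx
    have h3 := mp_pr.quasiMeasurePreserving.ae hx
    simp only [nint_pr] at h3
    rw [ae_restrict_iff' measurableSet_Icc] at h3
    rw [← hvol]
    refine measure_congr ?_
    filter_upwards [h3] with γ hγ
    exact propext ⟨fun h => h.1, fun h => ⟨h, hγ h⟩⟩
  have hB : Summable (fun r => ψ r * Real.log (1 / ψ r)) → ∀ x : ℝ × ℝ,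
      volume {γ ∈ Set.Icc (0 : ℝ × ℝ) 1 |
          {q : ℤ | q ≠ 0 ∧
            nint (q * x.1 - γ.1) * nint (q * x.2 - γ.2) ≤ ψ q.natAbs}.Infinite} = 0 := by
    intro hsum x
    have h3 := mp_pr.quasiMeasurePreserving.ae (conv_TT ψ hpos hanti hlt hsum (pr x))
    simp only [nint_pr] at h3
    rw [ae_restrict_iff' measurableSet_Icc, ae_iff] at h3
    refine measure_mono_null ?_ h3
    rintro γ ⟨h1, h2⟩ h
    exact h2 (h h1)
  by_cases hs : Summable (fun r => ψ r * Real.log (1 / ψ r))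
  · exact Eventually.of_forall fun x => ⟨fun h => absurd hs h, fun _ => hB hs x⟩
  · filter_upwards [hA hs] with x hx
    exact ⟨fun _ => hx, fun h => absurd h hs⟩
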